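/- Proposition (valid solutions): assume z = ∑_{1 ≤ p ≤ q ≤ n} |Q_{p,q}|. For every binary vector x ∈ {0,1}^n that is valid, i.e. x_i = 0 or x_j = 0, the minimum over the two ancilla values of the modified energy equals the original energy: min(H_mod(x, 0), H_mod(x, 1)) = H(x). -/

import Mathlib

/-- The QUBO energy `H(x) = ∑_{p ≤ q} x_p x_q Q_{p,q}`. -/
def energy {m : ℕ} (A : Matrix (Fin m) (Fin m) ℝ) (x : Fin m → ℝ) : ℝ :=
  ∑ p : Fin m, ∑ q ∈ Finset.Ici p, x p * x q * A p q

/-- `x` is a binary ({0,1}-valued) vector. -/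
def IsBinary {m : ℕ} (x : Fin m → ℝ) : Prop := ∀ p, x p = 0 ∨ x p = 1

/-- The row/column of the ancilla qubit in the enhanced matrix. -/
def ancRow {n : ℕ} (Q : Matrix (Fin n) (Fin n) ℝ) (i j : Fin n) (U : Finset (Fin n)) (z : ℝ)
    (k : Fin n) : ℝ :=
  if k = i ∨ k = j then -2 * z else if k ∈ U then Q i k else 0

/-- The enhanced matrix restricted to the original `n × n` block. -/
def coreMod {n : ℕ} (Q : Matrix (Fin n) (Fin n) ℝ) (i j : Fin n) (U : Finset (Fin n)) (z : ℝ) :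
    Matrix (Fin n) (Fin n) ℝ := fun p q =>
  if p = i ∧ q = i then Q i i + z
  else if p = j ∧ q = j then Q j j + z
  else if (p = i ∧ q = j) ∨ (p = j ∧ q = i) then 2 * z
  else if ((p = i ∨ p = j) ∧ q ∈ U) ∨ (p ∈ U ∧ (q = i ∨ q = j)) then 0
  else Q p q

/-- The enhanced `(n+1) × (n+1)` matrix `Q_mod`, the ancilla being the last index. -/
def QMod {n : ℕ} (Q : Matrix (Fin n) (Fin n) ℝ) (i j : Fin n) (U : Finset (Fin n)) (z : ℝ) :
    Matrix (Fin (n + 1)) (Fin (n + 1)) ℝ := fun p q =>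
  Fin.lastCases
    (Fin.lastCases z (fun k => ancRow Q i j U z k) q)
    (fun p' => Fin.lastCases (ancRow Q i j U z p') (fun q' => coreMod Q i j U z p' q') q)
    p

/-- The modified energy `H_mod(x, b)`: the energy of `x` extended by the ancilla value `b`. -/
noncomputable def energyMod {n : ℕ} (Q : Matrix (Fin n) (Fin n) ℝ) (i j : Fin n)
    (U : Finset (Fin n)) (z : ℝ) (x : Fin n → ℝ) (b : ℝ) : ℝ :=
  energy (QMod Q i j U z) (Fin.snoc x b)

/-- `z = ∑_{p ≤ q} |Q_{p,q}|`, the value of `z` used in the correctness proposition. -/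
def totalWeight {n : ℕ} (Q : Matrix (Fin n) (Fin n) ℝ) : ℝ :=
  ∑ p : Fin n, ∑ q ∈ Finset.Ici p, |Q p q|

lemma sum_Ici_eq_sum_ite {m : ℕ} (f : Fin m → Fin m → ℝ) :
    ∑ p, ∑ q ∈ Finset.Ici p, f p q = ∑ p, ∑ q, if p ≤ q then f p q else 0 := by
  refine Finset.sum_congr rfl fun p _ => ?_
  rw [← Finset.sum_filter]
  congr 1
  ext q
  simp

/-- Twice the upper-triangular sum of a symmetric function is its full sum plus its diagonal. -/
lemma two_mul_sum_Ici_of_symm {m : ℕ} (f : Fin m → Fin m → ℝ) (hf : ∀ p q, f p q = f q p) :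
    2 * ∑ p, ∑ q ∈ Finset.Ici p, f p q = (∑ p, ∑ q, f p q) + ∑ p, f p p := by
  have lower : ∑ p, ∑ q ∈ Finset.Ici p, f p q = ∑ p, ∑ q, if q ≤ p then f p q else 0 := by
    rw [sum_Ici_eq_sum_ite, Finset.sum_comm]
    simp only [hf]
  have diag : ∑ p, f p p = ∑ p, ∑ q, if p = q then f p q else 0 := by simp
  rw [two_mul, diag]
  nth_rewrite 1 [sum_Ici_eq_sum_ite]
  rw [lower]
  simp only [← Finset.sum_add_distrib]
  refine Finset.sum_congr rfl fun p _ => Finset.sum_congr rfl fun q _ => ?_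
  rcases lt_trichotomy p q with h | h | h
  · simp [h.le, h.not_ge, h.ne]
  · simp [h]
  · simp [h.le, h.not_ge, h.ne']

lemma two_mul_energy {m : ℕ} {A : Matrix (Fin m) (Fin m) ℝ} (hA : ∀ p q, A p q = A q p)
    (x : Fin m → ℝ) :
    2 * energy A x = (∑ p, ∑ q, x p * x q * A p q) + ∑ p, x p * x p * A p p :=
  two_mul_sum_Ici_of_symm (fun p q => x p * x q * A p q) fun p q => by
    rw [hA p q, mul_comm (x p)]

lemma sum_abs_row_le_totalWeight {n : ℕ} {Q : Matrix (Fin n) (Fin n) ℝ}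
    (hQ : ∀ p q, Q p q = Q q p) {i : Fin n} {U : Finset (Fin n)} (hi : i ∉ U) :
    ∑ k ∈ U, |Q i k| ≤ totalWeight Q := by
  have h := two_mul_sum_Ici_of_symm (fun p q => |Q p q|) fun p q => by rw [hQ p q]
  have hdiag : 0 ≤ ∑ p, |Q p p| := Finset.sum_nonneg fun p _ => abs_nonneg _
  have hle : ∑ p, ∑ q, ((if p = i then if q ∈ U then |Q i q| else 0 else 0) +
      (if q = i then if p ∈ U then |Q i p| else 0 else 0)) ≤ ∑ p, ∑ q, |Q p q| := by
    refine Finset.sum_le_sum fun p _ => Finset.sum_le_sum fun q _ => ?_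
    have := abs_nonneg (Q p q)
    have := hQ p q
    clear h hdiag
    grind
  have hsum : ∑ p, ∑ q, ((if p = i then if q ∈ U then |Q i q| else 0 else 0) +
      (if q = i then if p ∈ U then |Q i p| else 0 else 0)) = 2 * ∑ k ∈ U, |Q i k| := by
    simp only [Finset.sum_add_distrib]
    rw [Finset.sum_comm]
    simp [two_mul]
  unfold totalWeight
  linarith

lemma energyMod_eq {n : ℕ} (Q : Matrix (Fin n) (Fin n) ℝ) (i j : Fin n)
    (U : Finset (Fin n)) (z : ℝ) (x : Fin n → ℝ) (b : ℝ) :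
    energyMod Q i j U z x b =
      energy (coreMod Q i j U z) x + b * ∑ p, x p * ancRow Q i j U z p + b * b * z := by
  unfold energyMod energy
  rw [sum_Ici_eq_sum_ite, sum_Ici_eq_sum_ite]
  simp only [Fin.sum_univ_castSucc, QMod, Fin.snoc_castSucc, Fin.snoc_last, Fin.lastCases_castSucc,
    Fin.lastCases_last, Fin.castSucc_le_castSucc_iff, Fin.le_last, if_true,
    Fin.last_le_iff, Fin.castSucc_ne_last, if_false, Finset.sum_const_zero, add_zero, ← add_assoc,
    Finset.sum_add_distrib, Finset.mul_sum]
  congr 2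
  exact Finset.sum_congr rfl fun p _ => by ring

lemma coreMod_symm {n : ℕ} {Q : Matrix (Fin n) (Fin n) ℝ} (hQ : ∀ p q, Q p q = Q q p)
    (i j : Fin n) (U : Finset (Fin n)) (z : ℝ) (p q : Fin n) :
    coreMod Q i j U z p q = coreMod Q i j U z q p := by
  have := hQ p q
  unfold coreMod
  grind

lemma energy_coreMod {n : ℕ} {Q : Matrix (Fin n) (Fin n) ℝ} (hQ : ∀ p q, Q p q = Q q p)
    {i j : Fin n} (hij : i ≠ j) {U : Finset (Fin n)} (hiU : i ∉ U) (hjU : j ∉ U)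
    (hU : ∀ k ∈ U, Q i k = Q j k) (z : ℝ) {x : Fin n → ℝ} (hvalid : x i * x j = 0) :
    energy (coreMod Q i j U z) x = energy Q x + z * (x i * x i + x j * x j)
      - (x i + x j) * ∑ k ∈ U, x k * Q i k := by
  have key (p q : Fin n) : x p * x q * coreMod Q i j U z p q = x p * x q * Q p q
      + (if p = i then if q = i then z * (x i * x i) else 0 else 0)
      + (if p = j then if q = j then z * (x j * x j) else 0 else 0)
      - (if p = i then if q ∈ U then x i * (x q * Q i q) else 0 else 0)
      - (if p = j then if q ∈ U then x j * (x q * Q i q) else 0 else 0)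
      - (if q = i then if p ∈ U then x i * (x p * Q i p) else 0 else 0)
      - (if q = j then if p ∈ U then x j * (x p * Q i p) else 0 else 0) := by
    have := hQ p q
    have := hU p
    have := hU q
    unfold coreMod
    grind
  have full : ∑ p, ∑ q, x p * x q * coreMod Q i j U z p q =
      (∑ p, ∑ q, x p * x q * Q p q) + z * (x i * x i) + z * (x j * x j)
        - 2 * ((x i + x j) * ∑ k ∈ U, x k * Q i k) := by
    simp only [key, Finset.sum_add_distrib, Finset.sum_sub_distrib]
    simp [Finset.sum_ite_irrel, ← Finset.mul_sum]
    ring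
  have diag : ∑ p, x p * x p * coreMod Q i j U z p p =
      (∑ p, x p * x p * Q p p) + z * (x i * x i) + z * (x j * x j) := by
    have (p : Fin n) : x p * x p * coreMod Q i j U z p p = x p * x p * Q p p
        + (if p = i then z * (x i * x i) else 0) + (if p = j then z * (x j * x j) else 0) := by
      clear key full
      unfold coreMod
      grind
    simp [this, Finset.sum_add_distrib]
  have h₁ := two_mul_energy (coreMod_symm hQ i j U z) x
  have h₂ := two_mul_energy hQ x
  linarith

lemma sum_mul_ancRow {n : ℕ} (Q : Matrix (Fin n) (Fin n) ℝ) {i j : Fin n} (hij : i ≠ j)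
    {U : Finset (Fin n)} (hiU : i ∉ U) (hjU : j ∉ U) (z : ℝ) (x : Fin n → ℝ) :
    ∑ p, x p * ancRow Q i j U z p = -2 * z * (x i + x j) + ∑ k ∈ U, x k * Q i k := by
  have (p : Fin n) : x p * ancRow Q i j U z p = (if p = i then -2 * z * x i else 0)
      + (if p = j then -2 * z * x j else 0) + (if p ∈ U then x p * Q i p else 0) := by
    unfold ancRow
    grind
  simp only [this, Finset.sum_add_distrib]
  simp
  ring

theorem valid_solutions_preserve_energy {n : ℕ} (Q : Matrix (Fin n) (Fin n) ℝ) (hQ : Q.IsSymm)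
    (i j : Fin n) (hij : i ≠ j) (U : Finset (Fin n)) (hiU : i ∉ U) (hjU : j ∉ U)
    (hU : ∀ k ∈ U, Q i k = Q j k) (z : ℝ)
    (x : Fin n → ℝ) (hx : IsBinary x)
    (hz : z = totalWeight Q) (hvalid : x i = 0 ∨ x j = 0) :
    min (energyMod Q i j U z x 0) (energyMod Q i j U z x 1) = energy Q x := by
  have hsymm (p q : Fin n) : Q p q = Q q p := hQ.apply q p
  have hprod : x i * x j = 0 := mul_eq_zero.mpr hvalid
  have hS : |∑ k ∈ U, x k * Q i k| ≤ z := by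
    rw [hz]
    refine (Finset.abs_sum_le_sum_abs _ _).trans
      ((Finset.sum_le_sum fun k _ => ?_).trans (sum_abs_row_le_totalWeight hsymm hiU))
    rcases hx k with h | h <;> simp [h]
  rw [energyMod_eq, energyMod_eq, energy_coreMod hsymm hij hiU hjU hU z hprod,
    sum_mul_ancRow Q hij hiU hjU]
  obtain ⟨hlo, hhi⟩ := abs_le.mp hS
  rcases hx i with hi | hi <;> rcases hx j with hj | hj
  · rw [hi, hj, min_eq_left] <;> linarith
  · rw [hi, hj, min_eq_right] <;> linarith
  · rw [hi, hj, min_eq_right] <;> linarith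
  · simp [hi, hj] at hprod
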